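/- In the abstract framework (case Σ = ℝⁿ), let Assumptions 1 and 2 hold and let μ be a real number with K < μ < 1. Choose T₀ > 0 and ζ ∈ (0, 1/(2p)). Then there exists a positive constant ε(T₀, ζ, μ) such that, if one runs version A of the restarted Anderson–Pulay acceleration with adaptive restart parameter τ⁽ᵏ⁻ᵐ_k⁾ = T₀‖r⁽ᵏ⁻ᵐ_k⁾‖₂^ζ from an initial point x⁽⁰⁾ ∈ U with 0 < ‖r⁽⁰⁾‖₂ < ε(T₀, ζ, μ), then the sequence (x⁽ᵏ⁾) is well defined, satisfies m_k ≤ min(k, p) and ‖r⁽ᵏ⁾‖₂ ≤ μᵏ‖r⁽⁰⁾‖₂ for all k, and converges superlinearly to x* with r-order at least (1 + min{ζ, 1 − 2pζ})^{1/p}. -/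

import Mathlib

/-- A run `(x, m, c)` of version A of the restarted Anderson–Pulay acceleration
(Algorithm 3') with error function `f`, fixed-point function `g` and the adaptive restart
parameter `τ⁽ᵏ⁻ᵐ_k⁾ = T₀‖r⁽ᵏ⁻ᵐ_k⁾‖₂^ζ` in the restart test. -/
def RestartRunAdaptive {n p : ℕ}
    (f : EuclideanSpace ℝ (Fin n) → EuclideanSpace ℝ (Fin p))
    (g : EuclideanSpace ℝ (Fin n) → EuclideanSpace ℝ (Fin n)) (T₀ ζ : ℝ)
    (x : ℕ → EuclideanSpace ℝ (Fin n)) (m : ℕ → ℕ) (c : ℕ → ℕ → ℝ) : Prop :=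
  m 0 = 0 ∧
  ∀ k : ℕ,
    (f (x k) = 0 → x (k + 1) = x k) ∧
    (f (x (k + 1)) = 0 → m (k + 1) = 0) ∧
    (f (x k) ≠ 0 → m k = 0 → x (k + 1) = g (x k) ∧ c k 0 = 1) ∧
    (f (x k) ≠ 0 → 1 ≤ m k →
      (∑ i ∈ Finset.range (m k + 1), c k i) = 1 ∧
      (∀ d : ℕ → ℝ, (∑ i ∈ Finset.range (m k + 1), d i) = 1 →
        ‖∑ i ∈ Finset.range (m k + 1), c k i • f (x (k - m k + i))‖ ≤
          ‖∑ i ∈ Finset.range (m k + 1), d i • f (x (k - m k + i))‖) ∧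
      x (k + 1) = ∑ i ∈ Finset.range (m k + 1), c k i • g (x (k - m k + i))) ∧
    (f (x (k + 1)) ≠ 0 →
      (T₀ * ‖f (x (k - m k))‖ ^ ζ * ‖f (x (k + 1)) - f (x (k - m k))‖ >
          Metric.infDist (f (x (k + 1)) - f (x (k - m k)))
            (Submodule.span ℝ
              ((fun i => f (x (k - m k + i)) - f (x (k - m k))) '' Set.Icc 1 (m k)) :
              Set (EuclideanSpace ℝ (Fin p))) →
        m (k + 1) = 0) ∧
      (T₀ * ‖f (x (k - m k))‖ ^ ζ * ‖f (x (k + 1)) - f (x (k - m k))‖ ≤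
          Metric.infDist (f (x (k + 1)) - f (x (k - m k)))
            (Submodule.span ℝ
              ((fun i => f (x (k - m k + i)) - f (x (k - m k))) '' Set.Icc 1 (m k)) :
              Set (EuclideanSpace ℝ (Fin p))) →
        m (k + 1) = m k + 1))

open Filter Topology

theorem aux_fderiv_le {E F G : Type*} [NormedAddCommGroup E] [NormedSpace ℝ E]
    [NormedAddCommGroup F] [NormedSpace ℝ F] [NormedAddCommGroup G] [NormedSpace ℝ G]
    (φ : E → F) (ψ : E → G) (φ' : E →L[ℝ] F) (ψ' : E →L[ℝ] G) (xs : E)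
    (hφ : HasFDerivAt φ φ' xs) (hψ : HasFDerivAt ψ ψ' xs) (hφ0 : φ xs = 0) (hψ0 : ψ xs = 0)
    (K : ℝ) (h : ∀ᶠ x in 𝓝 xs, ‖φ x‖ ≤ K * ‖ψ x‖) (v : E) : ‖φ' v‖ ≤ K * ‖ψ' v‖ := by
  have h1 := (hφ.hasLineDerivAt v).tendsto_slope_zero
  have h2 := (hψ.hasLineDerivAt v).tendsto_slope_zero
  have hc : Tendsto (fun t : ℝ => xs + t • v) (𝓝[≠] 0) (𝓝 xs) := by
    have : ContinuousAt (fun t : ℝ => xs + t • v) 0 := by fun_prop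
    have h3 := this.tendsto
    simp only [zero_smul, add_zero] at h3
    exact h3.mono_left nhdsWithin_le_nhds
  refine le_of_tendsto_of_tendsto h1.norm (h2.norm.const_mul K) ?_
  filter_upwards [hc.eventually h] with t ht
  simp only [hφ0, hψ0, sub_zero, norm_smul]
  calc ‖t⁻¹‖ * ‖φ (xs + t • v)‖ ≤ ‖t⁻¹‖ * (K * ‖ψ (xs + t • v)‖) := by gcongr
    _ = _ := by ring

theorem aux_coef {F : Type*} [NormedAddCommGroup F] [NormedSpace ℝ F] (s : ℕ → F) (τ : ℝ)
    (hτ : 0 < τ) (hτ1 : τ ≤ 1) (m : ℕ)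
    (h : ∀ j < m, ∀ b : ℕ → ℝ, τ * ‖s j‖ ≤ ‖s j - ∑ i ∈ Finset.range j, b i • s i‖)
    (a : ℕ → ℝ) : ∀ j < m, |a j| * ‖s j‖ ≤
      (2 / τ) ^ (m - 1) * ‖∑ i ∈ Finset.range m, a i • s i‖ := by
  have h2 : 1 ≤ 2 / τ := by rw [le_div_iff₀ hτ]; linarith
  induction m with
  | zero => intro j hj; omega
  | succ m ih =>
    rcases Nat.eq_zero_or_pos m with rfl | hm
    · intro j hj
      have : j = 0 := by omega
      subst this
      simp [norm_smul]
    · have ih' := ih (fun j hj => h j (by omega))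
      set v := ∑ i ∈ Finset.range (m + 1), a i • s i with hv
      have hv' : v = ∑ i ∈ Finset.range m, a i • s i + a m • s m := by
        rw [hv, Finset.sum_range_succ]
      have hlast : |a m| * ‖s m‖ ≤ (1 / τ) * ‖v‖ := by
        by_cases ha : a m = 0
        · rw [ha]; simp; positivity
        · have hh := h m (by omega) (fun i => - (a i / a m))
          have e : v = a m • (s m - ∑ i ∈ Finset.range m, (-(a i / a m)) • s i) := by
            rw [hv', smul_sub, Finset.smul_sum]
            simp only [smul_smul]
            have : ∀ i, a m * -(a i / a m) = - a i := by intro i; field_simp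
            simp only [this, neg_smul, Finset.sum_neg_distrib]
            abel
          rw [e, norm_smul, Real.norm_eq_abs, div_mul_eq_mul_div, le_div_iff₀ hτ]
          have := mul_le_mul_of_nonneg_left hh (abs_nonneg (a m))
          linarith
      have e1 : (2 / τ) ^ (m + 1 - 1) = (2 / τ) ^ (m - 1) * (2 / τ) := by
        rw [← pow_succ]; congr 1; omega
      have hpos : 1 ≤ (2 / τ) ^ (m - 1) := one_le_pow₀ h2
      have hq : 1 / τ ≤ 2 / τ := by gcongr; norm_num
      intro j hj
      rcases Nat.lt_succ_iff_lt_or_eq.mp hj with hj | rfl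
      · have hw : ‖∑ i ∈ Finset.range m, a i • s i‖ ≤ (2 / τ) * ‖v‖ := by
          have : ∑ i ∈ Finset.range m, a i • s i = v - a m • s m := by rw [hv']; abel
          rw [this]
          refine (norm_sub_le _ _).trans ?_
          rw [norm_smul, Real.norm_eq_abs]
          have : 2 / τ = 1 / τ + 1 / τ := by ring
          have h1 : 1 ≤ 1 / τ := by rw [le_div_iff₀ hτ]; linarith
          have := mul_le_mul_of_nonneg_right h1 (norm_nonneg v)
          rw [‹2 / τ = _›, add_mul]; linarith
        rw [e1, mul_assoc]
        exact (ih' j hj).trans (by gcongr)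
      · refine hlast.trans ?_
        gcongr
        rw [e1]
        calc 1 / τ ≤ 1 * (2 / τ) := by linarith
          _ ≤ _ := by gcongr

theorem aux_key {E F : Type*} [NormedAddCommGroup E] [NormedSpace ℝ E]
    [NormedAddCommGroup F] [NormedSpace ℝ F] (f : E → F) (g : E → E) (xs : E)
    (A : E →L[ℝ] F) (B : E →L[ℝ] E) (K L L' : ℝ) (hK : 0 ≤ K) (U : Set E)
    (hAB : ∀ v, ‖A (B v)‖ ≤ K * ‖A v‖)
    (htay1 : ∀ x ∈ U, ‖f x - A (x - xs)‖ ≤ L / 2 * ‖x - xs‖ ^ 2)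
    (htay2 : ∀ x ∈ U, ‖g x - xs - B (x - xs)‖ ≤ L' / 2 * ‖x - xs‖ ^ 2)
    (m : ℕ) (y : ℕ → E) (c : ℕ → ℝ) (hc : ∑ i ∈ Finset.range (m + 1), c i = 1)
    (hy : ∀ i ≤ m, y i ∈ U) :
    ‖A ((∑ i ∈ Finset.range (m + 1), c i • g (y i)) - xs)‖ ≤
      K * ‖∑ i ∈ Finset.range (m + 1), c i • f (y i)‖ + (K * (L / 2) + ‖A‖ * (L' / 2)) *
        ∑ i ∈ Finset.range (m + 1), |c i| * ‖y i - xs‖ ^ 2 := by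
  set S := Finset.range (m + 1) with hS
  set Q := ∑ i ∈ S, |c i| * ‖y i - xs‖ ^ 2 with hQ
  set e := ∑ i ∈ S, c i • (y i - xs) with he
  have hyS : ∀ i ∈ S, y i ∈ U := fun i hi => hy i (by simp [hS] at hi; omega)
  have h1 : ‖∑ i ∈ S, c i • (f (y i) - A (y i - xs))‖ ≤ L / 2 * Q := by
    rw [hQ, Finset.mul_sum]
    refine norm_sum_le_of_le _ fun i hi => ?_
    rw [norm_smul, Real.norm_eq_abs]
    calc _ ≤ |c i| * (L / 2 * ‖y i - xs‖ ^ 2) := by gcongr; exact htay1 _ (hyS i hi)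
      _ = _ := by ring
  have h2 : ‖∑ i ∈ S, c i • (g (y i) - xs - B (y i - xs))‖ ≤ L' / 2 * Q := by
    rw [hQ, Finset.mul_sum]
    refine norm_sum_le_of_le _ fun i hi => ?_
    rw [norm_smul, Real.norm_eq_abs]
    calc _ ≤ |c i| * (L' / 2 * ‖y i - xs‖ ^ 2) := by gcongr; exact htay2 _ (hyS i hi)
      _ = _ := by ring
  have e1 : ∑ i ∈ S, c i • (f (y i) - A (y i - xs)) = ∑ i ∈ S, c i • f (y i) - A e := by
    simp [he, smul_sub, Finset.sum_sub_distrib]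
  have e2 : ∑ i ∈ S, c i • (g (y i) - xs - B (y i - xs)) =
      (∑ i ∈ S, c i • g (y i)) - xs - B e := by
    have : xs = ∑ i ∈ S, c i • xs := by rw [← Finset.sum_smul, hc, one_smul]
    conv_rhs => rw [this]
    simp only [he, smul_sub, Finset.sum_sub_distrib, map_sub, map_sum, map_smul]
  rw [e1] at h1
  rw [e2] at h2
  set w := (∑ i ∈ S, c i • g (y i)) - xs with hw
  have h3 : ‖A e‖ ≤ ‖∑ i ∈ S, c i • f (y i)‖ + L / 2 * Q := by
    have := norm_sub_norm_le (A e) (∑ i ∈ S, c i • f (y i))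
    rw [norm_sub_rev] at this
    linarith
  have h4 : A w = A (B e) + A (w - B e) := by simp
  rw [h4]
  calc _ ≤ ‖A (B e)‖ + ‖A (w - B e)‖ := norm_add_le _ _
    _ ≤ K * ‖A e‖ + ‖A‖ * ‖w - B e‖ := add_le_add (hAB e) (A.le_opNorm _)
    _ ≤ K * (‖∑ i ∈ S, c i • f (y i)‖ + L / 2 * Q) + ‖A‖ * (L' / 2 * Q) := by gcongr
    _ = _ := by ring

theorem aux_Q {F : Type*} [NormedAddCommGroup F] [NormedSpace ℝ F]
    (r : ℕ → F) (d : ℕ → ℝ) (c : ℕ → ℝ) (m p : ℕ) (hmp : m ≤ p) (σ μ τ : ℝ) (hσ : 0 < σ)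
    (hμ0 : 0 < μ) (hμ1 : μ < 1) (hτ : 0 < τ) (hτ1 : τ ≤ 1) (hp : 0 < p)
    (hd0 : ∀ i ≤ m, 0 ≤ d i)
    (hd : ∀ i ≤ m, σ * d i ≤ ‖r i‖)
    (hc : ∑ i ∈ Finset.range (m + 1), c i = 1)
    (hR : ‖∑ i ∈ Finset.range (m + 1), c i • r i‖ ≤ ‖r m‖)
    (hdec : ∀ i, 1 ≤ i → i ≤ m → ‖r i‖ ≤ μ * ‖r 0‖) (hr0 : 0 < ‖r 0‖)
    (h : ∀ j < m, ∀ b : ℕ → ℝ, τ * ‖r (j + 1) - r 0‖ ≤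
      ‖r (j + 1) - r 0 - ∑ i ∈ Finset.range j, b i • (r (i + 1) - r 0)‖) :
    ∑ i ∈ Finset.range (m + 1), |c i| * d i ^ 2 ≤
      (2 * p * (p + 1) / (1 - μ) * (2 / τ) ^ (p - 1) * ‖r 0‖ * ‖r m‖ + ‖r m‖ ^ 2) / σ ^ 2 := by
  set ρ := ‖r 0‖ with hρ
  set κ := (2 / τ) ^ (p - 1) with hκ
  have hκ0 : 0 < κ := by positivity
  have h1μ : 0 < 1 - μ := by linarith
  set a : ℕ → ℝ := fun i => c i - if i = m then 1 else 0 with ha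
  have hasum : ∑ i ∈ Finset.range (m + 1), a i = 0 := by
    simp [ha, Finset.sum_sub_distrib, hc]
  have hasumr : ∑ i ∈ Finset.range (m + 1), a i • r i =
      ∑ i ∈ Finset.range (m + 1), c i • r i - r m := by
    simp [ha, sub_smul, Finset.sum_sub_distrib]
  have hshift : ∑ i ∈ Finset.range (m + 1), a i • r i =
      ∑ i ∈ Finset.range m, a (i + 1) • (r (i + 1) - r 0) := by
    have : ∑ i ∈ Finset.range (m + 1), a i • r i =
        ∑ i ∈ Finset.range (m + 1), a i • (r i - r 0) := by
      simp only [smul_sub, Finset.sum_sub_distrib, ← Finset.sum_smul, hasum]; simp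
    rw [this, Finset.sum_range_succ']; simp
  have hv : ‖∑ i ∈ Finset.range m, a (i + 1) • (r (i + 1) - r 0)‖ ≤ 2 * ‖r m‖ := by
    rw [← hshift, hasumr]
    exact (norm_sub_le _ _).trans (by linarith)
  set M := 2 * κ * ‖r m‖ / ((1 - μ) * ρ) with hM
  have hM0 : 0 ≤ M := by positivity
  have hco : ∀ j < m, |a (j + 1)| ≤ M := by
    intro j hj
    have h1 := aux_coef (fun i => r (i + 1) - r 0) τ hτ hτ1 m h (fun i => a (i + 1)) j hj
    have h2 : (2 / τ) ^ (m - 1) ≤ κ := by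
      apply pow_le_pow_right₀ _ (by omega)
      rw [le_div_iff₀ hτ]; linarith
    have h3 : (1 - μ) * ρ ≤ ‖r (j + 1) - r 0‖ := by
      have := norm_sub_norm_le (r 0) (r (j + 1))
      rw [norm_sub_rev] at this
      have := hdec (j + 1) (by omega) (by omega)
      nlinarith
    rw [hM, le_div_iff₀ (by positivity)]
    calc _ ≤ |a (j + 1)| * ‖r (j + 1) - r 0‖ := by gcongr
      _ ≤ _ := h1
      _ ≤ κ * (2 * ‖r m‖) := by gcongr
      _ = _ := by ring
  have hp1 : (1 : ℝ) ≤ p := by exact_mod_cast hp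
  have hcall : ∀ i ≤ m, |a i| ≤ p * M := by
    intro i hi
    rcases Nat.eq_zero_or_pos i with rfl | hi0
    · rw [Finset.sum_range_succ'] at hasum
      have : a 0 = - ∑ k ∈ Finset.range m, a (k + 1) := by linarith
      rw [this, abs_neg]
      calc _ ≤ ∑ k ∈ Finset.range m, |a (k + 1)| := Finset.abs_sum_le_sum_abs _ _
        _ ≤ ∑ k ∈ Finset.range m, M := Finset.sum_le_sum fun k hk => hco k (by simpa using hk)
        _ = m * M := by simp
        _ ≤ _ := by gcongr
    · obtain ⟨j, rfl⟩ : ∃ j, i = j + 1 := ⟨i - 1, by omega⟩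
      have := hco j (by omega)
      nlinarith
  have hrm : ∀ i ≤ m, ‖r i‖ ≤ ρ := by
    intro i hi
    rcases Nat.eq_zero_or_pos i with rfl | hi0
    · exact le_rfl
    · have := hdec i hi0 hi
      nlinarith
  have hdi : ∀ i ≤ m, d i ^ 2 ≤ ‖r i‖ ^ 2 / σ ^ 2 := by
    intro i hi
    rw [le_div_iff₀ (by positivity), ← mul_pow]
    have := hd0 i hi
    exact pow_le_pow_left₀ (by positivity) (by linarith [hd i hi]) 2
  have hterm : ∀ i ∈ Finset.range (m + 1), |c i| * d i ^ 2 ≤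
      p * M * (ρ ^ 2 / σ ^ 2) + (if i = m then ‖r m‖ ^ 2 / σ ^ 2 else 0) := by
    intro i hi
    have hi : i ≤ m := by simp at hi; omega
    have h1 : |c i| ≤ |a i| + if i = m then 1 else 0 := by
      have : c i = a i + if i = m then 1 else 0 := by simp [ha]
      rw [this]
      refine (abs_add_le _ _).trans ?_
      split_ifs <;> simp
    have h2 := hcall i hi
    have h3 : d i ^ 2 ≤ ρ ^ 2 / σ ^ 2 := (hdi i hi).trans (by gcongr; exact hrm i hi)
    calc _ ≤ (|a i| + if i = m then 1 else 0) * d i ^ 2 := by gcongr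
      _ = |a i| * d i ^ 2 + (if i = m then 1 else 0) * d i ^ 2 := by ring
      _ ≤ _ := by
        gcongr
        split_ifs with hh
        · subst hh; simpa using hdi i hi
        · simp
  refine (Finset.sum_le_sum hterm).trans ?_
  rw [Finset.sum_add_distrib, Finset.sum_const, Finset.card_range, nsmul_eq_mul]
  simp only [Finset.sum_ite_eq', Finset.mem_range, Nat.lt_succ_self, if_true]
  rw [add_div]
  gcongr
  have : (p * M * (ρ ^ 2 / σ ^ 2)) * (p + 1) =
    2 * p * (p + 1) / (1 - μ) * κ * ρ * ‖r m‖ / σ ^ 2 := by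
    rw [hM]; field_simp
  rw [← this, mul_comm]
  gcongr
  push_cast
  gcongr

set_option maxHeartbeats 1000000 in
theorem aux_step {E F : Type*} [NormedAddCommGroup E] [NormedSpace ℝ E]
    [NormedAddCommGroup F] [NormedSpace ℝ F] (f : E → F) (g : E → E) (xs : E)
    (A : E →L[ℝ] F) (B : E →L[ℝ] E) (K L L' σ μ T₀ ζ C1 C2 C3 : ℝ) (p : ℕ) (hp : 0 < p)
    (hK : 0 < K) (hL : 0 < L) (hL' : 0 < L') (hσ : 0 < σ) (hKμ : K < μ) (hμ1 : μ < 1)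
    (hT₀ : 0 < T₀) (hζ0 : 0 < ζ)
    (hC1 : C1 = K * (L / 2) + ‖A‖ * (L' / 2))
    (hC2 : C2 = (2 * p * (p + 1) / (1 - μ) * (2 / T₀) ^ (p - 1) + 1) / σ ^ 2)
    (hC3 : C3 = C1 * C2 + L / (2 * σ ^ 2))
    (U : Set E)
    (hA : ∀ v, σ * ‖v‖ ≤ ‖A v‖)
    (hAB : ∀ v, ‖A (B v)‖ ≤ K * ‖A v‖)
    (hA2 : ∀ x ∈ U, σ * ‖x - xs‖ ≤ ‖f x‖)
    (htay1 : ∀ x ∈ U, ‖f x - A (x - xs)‖ ≤ L / 2 * ‖x - xs‖ ^ 2)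
    (htay2 : ∀ x ∈ U, ‖g x - xs - B (x - xs)‖ ≤ L' / 2 * ‖x - xs‖ ^ 2)
    (m : ℕ) (hmp : m ≤ p) (y : ℕ → E) (c : ℕ → ℝ)
    (hc : ∑ i ∈ Finset.range (m + 1), c i = 1)
    (hy : ∀ i ≤ m, y i ∈ U)
    (hR : ‖∑ i ∈ Finset.range (m + 1), c i • f (y i)‖ ≤ ‖f (y m)‖)
    (hdec : ∀ i, 1 ≤ i → i ≤ m → ‖f (y i)‖ ≤ μ * ‖f (y 0)‖) (hr0 : 0 < ‖f (y 0)‖)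
    (h : ∀ j < m, ∀ b : ℕ → ℝ, T₀ * ‖f (y 0)‖ ^ ζ * ‖f (y (j + 1)) - f (y 0)‖ ≤
      ‖f (y (j + 1)) - f (y 0) - ∑ i ∈ Finset.range j, b i • (f (y (i + 1)) - f (y 0))‖)
    (hs1 : ‖f (y 0)‖ ≤ 1) (hs2 : T₀ * ‖f (y 0)‖ ^ ζ ≤ 1)
    (hs3 : C3 * ‖f (y 0)‖ ^ (1 - ((p - 1 : ℕ) : ℝ) * ζ) ≤ μ - K)
    (hs4 : ∀ w, σ * ‖w - xs‖ ≤ ‖f (y 0)‖ → w ∈ U) :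
    (∑ i ∈ Finset.range (m + 1), c i • g (y i)) ∈ U ∧
    ‖f (∑ i ∈ Finset.range (m + 1), c i • g (y i))‖ ≤
      K * ‖∑ i ∈ Finset.range (m + 1), c i • f (y i)‖ +
        C3 * ‖f (y m)‖ * ‖f (y 0)‖ ^ (1 - ((p - 1 : ℕ) : ℝ) * ζ) ∧
    ‖f (∑ i ∈ Finset.range (m + 1), c i • g (y i))‖ ≤ μ * ‖f (y m)‖ := by
  have hμ0 : 0 < μ := hK.trans hKμ
  have h1μ : 0 < 1 - μ := by linarith
  have key := aux_key f g xs A B K L L' hK.le U hAB htay1 htay2 m y c hc hy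
  have hQ := aux_Q (fun i => f (y i)) (fun i => ‖y i - xs‖) c m p hmp σ μ (T₀ * ‖f (y 0)‖ ^ ζ)
    hσ hμ0 hμ1 (by positivity) hs2 hp (fun i _ => norm_nonneg _) (fun i hi => hA2 _ (hy i hi))
    hc hR hdec hr0 h
  set z := ∑ i ∈ Finset.range (m + 1), c i • g (y i) with hz
  set R := ‖∑ i ∈ Finset.range (m + 1), c i • f (y i)‖ with hRdef
  set Q := ∑ i ∈ Finset.range (m + 1), |c i| * ‖y i - xs‖ ^ 2 with hQdef
  have hrk : ‖f (y m)‖ ≤ ‖f (y 0)‖ := by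
    rcases Nat.eq_zero_or_pos m with rfl | hm
    · exact le_rfl
    · have := hdec m hm le_rfl
      nlinarith
  set rk := ‖f (y m)‖ with hrkdef
  set ρ := ‖f (y 0)‖ with hρ
  set β := ((p - 1 : ℕ) : ℝ) * ζ with hβ
  have hβ0 : 0 ≤ β := by positivity
  have hrk0 : 0 ≤ rk := norm_nonneg _
  have hR0 : 0 ≤ R := norm_nonneg _
  have hκ : (2 / (T₀ * ρ ^ ζ)) ^ (p - 1) * ρ = (2 / T₀) ^ (p - 1) * ρ ^ (1 - β) := by
    rw [Real.rpow_sub hr0, Real.rpow_one, hβ, mul_comm ((p - 1 : ℕ) : ℝ) ζ,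
      Real.rpow_mul_natCast hr0.le, ← div_div, div_pow]
    ring
  have hρβ : ρ ≤ ρ ^ (1 - β) := by
    conv_lhs => rw [← Real.rpow_one ρ]
    exact Real.rpow_le_rpow_of_exponent_ge hr0 hs1 (by linarith)
  set P := ρ ^ (1 - β) with hP
  have hP0 : 0 < P := by positivity
  have hC10 : 0 < C1 := by rw [hC1]; positivity
  have hC20 : 0 < C2 := by rw [hC2]; positivity
  have hQ2 : Q ≤ C2 * rk * P := by
    have hQ3 : Q ≤ (2 * p * (p + 1) / (1 - μ) * (2 / (T₀ * ρ ^ ζ)) ^ (p - 1) * ρ * rk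
      + rk ^ 2) / σ ^ 2 := hQ
    refine hQ3.trans ?_
    have e0 : C2 * rk * P = ((2 * p * (p + 1) / (1 - μ) * (2 / T₀) ^ (p - 1) + 1) * rk * P)
        / σ ^ 2 := by
      rw [hC2]; ring
    rw [e0]
    refine div_le_div_of_nonneg_right ?_ (by positivity)
    have e1 : 2 * (p : ℝ) * (p + 1) / (1 - μ) * (2 / (T₀ * ρ ^ ζ)) ^ (p - 1) * ρ * rk =
      2 * (p : ℝ) * (p + 1) / (1 - μ) * rk * ((2 / (T₀ * ρ ^ ζ)) ^ (p - 1) * ρ) := by ring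
    rw [e1, hκ]
    have : rk ^ 2 ≤ rk * P := by nlinarith
    calc _ ≤ 2 * (p : ℝ) * (p + 1) / (1 - μ) * rk * ((2 / T₀) ^ (p - 1) * P) + rk * P := by
          gcongr
      _ = _ := by ring
  have hW : ‖A (z - xs)‖ ≤ K * R + C1 * C2 * rk * P := by
    rw [← hC1] at key
    refine key.trans ?_
    have := mul_le_mul_of_nonneg_left hQ2 hC10.le
    linarith
  have hLσ : 0 < L / (2 * σ ^ 2) := by positivity
  have hC3' : C3 * P ≤ μ - K := hs3
  have hfin : K * R + C3 * rk * P ≤ μ * rk := by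
    have := mul_le_mul_of_nonneg_left hC3' hrk0
    have := mul_le_mul_of_nonneg_left hR hK.le
    linarith
  have hWrk : ‖A (z - xs)‖ ≤ rk := by
    have : C1 * C2 * rk * P ≤ C3 * rk * P := by
      gcongr; linarith
    have : μ * rk ≤ 1 * rk := by gcongr
    linarith
  have hzd : σ * ‖z - xs‖ ≤ rk := (hA _).trans hWrk
  have hzU : z ∈ U := hs4 z (hzd.trans hrk)
  have hfz : ‖f z‖ ≤ K * R + C3 * rk * P := by
    have t := htay1 z hzU
    have t1 : ‖f z‖ ≤ ‖A (z - xs)‖ + ‖f z - A (z - xs)‖ := by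
      have := norm_add_le (A (z - xs)) (f z - A (z - xs))
      simpa using this
    have t2 : L / 2 * ‖z - xs‖ ^ 2 ≤ L / (2 * σ ^ 2) * (rk * P) := by
      have h1 : (σ * ‖z - xs‖) ^ 2 ≤ rk * P := by
        calc _ ≤ rk ^ 2 := by gcongr
          _ ≤ _ := by nlinarith
      calc L / 2 * ‖z - xs‖ ^ 2 = L / (2 * σ ^ 2) * (σ * ‖z - xs‖) ^ 2 := by field_simp
        _ ≤ _ := by gcongr
    rw [hC3]
    linarith
  exact ⟨hzU, hfz, hfz.trans hfin⟩

theorem aux_surj {F : Type*} [NormedAddCommGroup F] [NormedSpace ℝ F] [FiniteDimensional ℝ F]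
    (s : ℕ → F) (τ : ℝ)
    (hτ : 0 < τ) (hτ1 : τ ≤ 1) (m : ℕ) (hm : m = Module.finrank ℝ F)
    (h : ∀ j < m, ∀ b : ℕ → ℝ, τ * ‖s j‖ ≤ ‖s j - ∑ i ∈ Finset.range j, b i • s i‖)
    (hs : ∀ j < m, s j ≠ 0) (w : F) : ∃ d : ℕ → ℝ, w = ∑ i ∈ Finset.range m, d i • s i := by
  have hli : LinearIndependent ℝ (fun i : Fin m => s i) := by
    rw [Fintype.linearIndependent_iff]
    intro a ha i
    let a' : ℕ → ℝ := fun i => if h : i < m then a ⟨i, h⟩ else 0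
    have h1 := aux_coef s τ hτ hτ1 m h a' i i.2
    have h2 : ∑ i ∈ Finset.range m, a' i • s i = 0 := by
      rw [Finset.sum_range, ← ha]
      refine Finset.sum_congr rfl fun i _ => ?_
      simp [a']
    rw [h2, norm_zero, mul_zero] at h1
    have h3 : 0 < ‖s i‖ := norm_pos_iff.mpr (hs i i.2)
    have h4 : |a' i| = 0 := by
      have := abs_nonneg (a' i)
      nlinarith
    simpa [a'] using h4
  have htop := hli.span_eq_top_of_card_eq_finrank' (by simpa using hm)
  have hw : w ∈ Submodule.span ℝ (Set.range (fun i : Fin m => s i)) := by rw [htop]; trivial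
  obtain ⟨a, ha⟩ := (Submodule.mem_span_range_iff_exists_fun ℝ).mp hw
  refine ⟨fun i => if h : i < m then a ⟨i, h⟩ else 0, ?_⟩
  rw [Finset.sum_range, ← ha]
  refine Finset.sum_congr rfl fun i _ => ?_
  simp

theorem aux_span {F : Type*} [NormedAddCommGroup F] [NormedSpace ℝ F] (s : ℕ → F) (m : ℕ)
    (w : F) : w ∈ Submodule.span ℝ (s '' Set.Icc 1 m) ↔
      ∃ d : ℕ → ℝ, w = ∑ i ∈ Finset.range m, d i • s (i + 1) := by
  have : s '' Set.Icc 1 m = Set.range (fun i : Fin m => s (i + 1)) := by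
    ext v
    constructor
    · rintro ⟨i, ⟨h1, h2⟩, rfl⟩
      refine ⟨⟨i - 1, by omega⟩, ?_⟩
      simp only
      congr 1; omega
    · rintro ⟨i, rfl⟩
      exact ⟨i + 1, ⟨by omega, by have := i.2; omega⟩, rfl⟩
  rw [this, Submodule.mem_span_range_iff_exists_fun]
  constructor
  · rintro ⟨a, ha⟩
    refine ⟨fun i => if h : i < m then a ⟨i, h⟩ else 0, ?_⟩
    rw [Finset.sum_range, ← ha]
    refine Finset.sum_congr rfl fun i _ => ?_
    simp
  · rintro ⟨d, rfl⟩
    exact ⟨fun i => d i, by rw [Finset.sum_range]⟩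

theorem aux_affine {F : Type*} [NormedAddCommGroup F] [NormedSpace ℝ F] (r : ℕ → F) (m : ℕ)
    (d : ℕ → ℝ) (hd : ∑ i ∈ Finset.range (m + 1), d i = 1) :
    ∑ i ∈ Finset.range (m + 1), d i • r i =
      r 0 + ∑ i ∈ Finset.range m, d (i + 1) • (r (i + 1) - r 0) := by
  have : ∑ i ∈ Finset.range (m + 1), d i • r i =
      r 0 + ∑ i ∈ Finset.range (m + 1), d i • (r i - r 0) := by
    simp only [smul_sub, Finset.sum_sub_distrib, ← Finset.sum_smul, hd]; simp
  rw [this, Finset.sum_range_succ']; simp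

/-- An affine combination with prescribed coefficients on the differences. -/
theorem aux_affine' {F : Type*} [NormedAddCommGroup F] [NormedSpace ℝ F] (m : ℕ)
    (d : ℕ → ℝ) : ∃ e : ℕ → ℝ, ∑ i ∈ Finset.range (m + 1), e i = 1 ∧ ∀ r : ℕ → F,
    ∑ i ∈ Finset.range (m + 1), e i • r i =
      r 0 + ∑ i ∈ Finset.range m, d i • (r (i + 1) - r 0) := by
  let e : ℕ → ℝ := fun i => if i = 0 then 1 - ∑ j ∈ Finset.range m, d j else d (i - 1)
  have he : ∑ i ∈ Finset.range (m + 1), e i = 1 := by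
    rw [Finset.sum_range_succ']; simp [e]
  refine ⟨e, he, fun r => ?_⟩
  rw [aux_affine r m e he]
  simp [e]

theorem aux_min {F : Type*} [NormedAddCommGroup F] [NormedSpace ℝ F] [FiniteDimensional ℝ F]
    (r : ℕ → F) (m : ℕ) :
    ∃ c : ℕ → ℝ, ∑ i ∈ Finset.range (m + 1), c i = 1 ∧ ∀ d : ℕ → ℝ,
      ∑ i ∈ Finset.range (m + 1), d i = 1 → ‖∑ i ∈ Finset.range (m + 1), c i • r i‖ ≤
        ‖∑ i ∈ Finset.range (m + 1), d i • r i‖ := by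
  have : ProperSpace F := FiniteDimensional.proper ℝ F
  set W := Submodule.span ℝ ((fun i => r i - r 0) '' Set.Icc 1 m) with hW
  obtain ⟨w, hw, hw2⟩ := (Submodule.closed_of_finiteDimensional W).exists_infDist_eq_dist
    ⟨0, W.zero_mem⟩ (-r 0)
  obtain ⟨d, hd⟩ := (aux_span _ _ _).mp hw
  obtain ⟨e, he, he2⟩ := aux_affine' (F := F) m d
  refine ⟨e, he, fun d' hd' => ?_⟩
  rw [he2 r, aux_affine r m d' hd', ← hd]
  have h1 : ∑ i ∈ Finset.range m, d' (i + 1) • (r (i + 1) - r 0) ∈ W :=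
    (aux_span _ _ _).mpr ⟨fun i => d' (i + 1), rfl⟩
  have h2 := Metric.infDist_le_dist_of_mem (x := -r 0) h1
  rw [SetLike.mem_coe] at *
  have e3 : ∀ u : F, ‖-r 0 - u‖ = ‖r 0 + u‖ := by
    intro u
    rw [← norm_neg]; congr 1; abel
  rw [hw2, dist_eq_norm, dist_eq_norm, e3, e3] at h2
  exact h2

theorem aux_exist {n p : ℕ}
    (f : EuclideanSpace ℝ (Fin n) → EuclideanSpace ℝ (Fin p))
    (g : EuclideanSpace ℝ (Fin n) → EuclideanSpace ℝ (Fin n)) (T₀ ζ : ℝ)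
    (x0 : EuclideanSpace ℝ (Fin n)) :
    ∃ x m c, x 0 = x0 ∧ RestartRunAdaptive f g T₀ ζ x m c := by
  classical
  have hstep : ∀ (y : ℕ → EuclideanSpace ℝ (Fin n)) (m : ℕ),
      ∃ (c : ℕ → ℝ) (xn : EuclideanSpace ℝ (Fin n)) (mn : ℕ),
      (f (y m) = 0 → xn = y m) ∧ (f xn = 0 → mn = 0) ∧
      (f (y m) ≠ 0 → m = 0 → xn = g (y m) ∧ c 0 = 1) ∧
      (f (y m) ≠ 0 → 1 ≤ m → (∑ i ∈ Finset.range (m + 1), c i) = 1 ∧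
      (∀ d : ℕ → ℝ, (∑ i ∈ Finset.range (m + 1), d i) = 1 →
        ‖∑ i ∈ Finset.range (m + 1), c i • f (y i)‖ ≤
          ‖∑ i ∈ Finset.range (m + 1), d i • f (y i)‖) ∧
      xn = ∑ i ∈ Finset.range (m + 1), c i • g (y i)) ∧
      (f xn ≠ 0 →
      (T₀ * ‖f (y 0)‖ ^ ζ * ‖f xn - f (y 0)‖ >
          Metric.infDist (f xn - f (y 0))
            (Submodule.span ℝ
              ((fun i => f (y i) - f (y 0)) '' Set.Icc 1 m) :
              Set (EuclideanSpace ℝ (Fin p))) →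
        mn = 0) ∧
      (T₀ * ‖f (y 0)‖ ^ ζ * ‖f xn - f (y 0)‖ ≤
          Metric.infDist (f xn - f (y 0))
            (Submodule.span ℝ
              ((fun i => f (y i) - f (y 0)) '' Set.Icc 1 m) :
              Set (EuclideanSpace ℝ (Fin p))) →
        mn = m + 1)) ∧ (mn = 0 ∨ mn = m + 1) := by
    intro y m
    obtain ⟨c, hc, hc2⟩ := aux_min (fun i => f (y i)) m
    let xn := if f (y m) = 0 then y m else ∑ i ∈ Finset.range (m + 1), c i • g (y i)
    let mn := if f xn = 0 then 0 else if T₀ * ‖f (y 0)‖ ^ ζ * ‖f xn - f (y 0)‖ >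
          Metric.infDist (f xn - f (y 0))
            (Submodule.span ℝ
              ((fun i => f (y i) - f (y 0)) '' Set.Icc 1 m) :
              Set (EuclideanSpace ℝ (Fin p))) then 0 else m + 1
    refine ⟨c, xn, mn, ?_, ?_, ?_, ?_, ?_, ?_⟩
    · intro h; simp only [xn, h, if_true]
    · intro h; simp only [mn, h, if_true]
    · rintro h rfl
      simp only [xn, h, if_false]
      simp at hc
      simp [hc]
    · intro h hm
      refine ⟨hc, hc2, ?_⟩
      simp only [xn, h, if_false]
    · intro h
      refine ⟨fun h2 => ?_, fun h2 => ?_⟩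
      · simp only [mn, h, if_false]; rw [if_pos h2]
      · simp only [mn, h, if_false]; rw [if_neg (not_lt.mpr h2)]
    · simp only [mn]; split_ifs <;> simp
  choose C X M h1 h2 h3 h4 h5 h6 using hstep
  let S : ℕ → (ℕ → EuclideanSpace ℝ (Fin n)) × ℕ := fun k => Nat.rec (fun _ => x0, 0)
    (fun _ s => (fun i => if i = M s.1 s.2 then X s.1 s.2 else s.1 i, M s.1 s.2)) k
  have hS : ∀ k, S (k + 1) = (fun i => if i = M (S k).1 (S k).2 then X (S k).1 (S k).2
    else (S k).1 i, M (S k).1 (S k).2) := fun k => rfl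
  let x : ℕ → EuclideanSpace ℝ (Fin n) := fun k => (S k).1 (S k).2
  let m : ℕ → ℕ := fun k => (S k).2
  have hxn : ∀ k, x (k + 1) = X (S k).1 (S k).2 := by
    intro k; simp only [x, hS]; simp
  have hmn : ∀ k, m (k + 1) = M (S k).1 (S k).2 := by
    intro k; simp only [m, hS]
  have hx : ∀ k, x k = (S k).1 (m k) := fun k => rfl
  have inv : ∀ k, m k ≤ k ∧ ∀ i ≤ m k, x (k - m k + i) = (S k).1 i := by
    intro k
    induction k with
    | zero =>
      refine ⟨le_rfl, fun i hi => ?_⟩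
      have : i = 0 := by simpa [m, S] using hi
      subst this
      simp [x, m, S]
    | succ k ih =>
      obtain ⟨ih1, ih2⟩ := ih
      rcases h6 (S k).1 (S k).2 with h | h
      · have hm0 : m (k + 1) = 0 := by rw [hmn, h]
        refine ⟨by omega, fun i hi => ?_⟩
        have : i = 0 := by omega
        subst this
        rw [hm0]
        simp only [Nat.sub_zero, Nat.add_zero]
        rw [hxn, hS]; simp [h]
      · have hm1 : m (k + 1) = m k + 1 := by rw [hmn, h]
        refine ⟨by omega, fun i hi => ?_⟩
        have e : k + 1 - m (k + 1) + i = k - m k + i := by omega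
        rw [e, hS]
        simp only [h]
        split_ifs with hi2
        · have : k - m k + i = k + 1 := by
            have : (S k).2 = m k := rfl
            omega
          rw [this, hxn]
        · apply ih2
          have : (S k).2 = m k := rfl
          omega
  refine ⟨x, m, fun k => C (S k).1 (S k).2, rfl, rfl, fun k => ?_⟩
  obtain ⟨i1, i2⟩ := inv k
  have hb : x (k - m k) = (S k).1 0 := by simpa using i2 0 (Nat.zero_le _)
  have hsumf : ∀ d : ℕ → ℝ, ∑ i ∈ Finset.range (m k + 1), d i • f (x (k - m k + i)) =
      ∑ i ∈ Finset.range (m k + 1), d i • f ((S k).1 i) := fun d =>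
    Finset.sum_congr rfl fun i hi => by rw [i2 i (by simp at hi; omega)]
  have hsumg : ∀ d : ℕ → ℝ, ∑ i ∈ Finset.range (m k + 1), d i • g (x (k - m k + i)) =
      ∑ i ∈ Finset.range (m k + 1), d i • g ((S k).1 i) := fun d =>
    Finset.sum_congr rfl fun i hi => by rw [i2 i (by simp at hi; omega)]
  have him : (fun i => f (x (k - m k + i)) - f (x (k - m k))) '' Set.Icc 1 (m k) =
      (fun i => f ((S k).1 i) - f ((S k).1 0)) '' Set.Icc 1 (m k) := by
    apply Set.image_congr
    intro i hi
    simp only [hb]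
    rw [i2 i hi.2]
  rw [him]
  simp only [hsumf, hsumg, hb, hxn, hmn, hx k]
  exact ⟨h1 _ _, h2 _ _, h3 _ _, h4 _ _, h5 _ _⟩

theorem aux_final (D q C4 rn ρ : ℝ) (a l : ℕ) (hD : 1 ≤ D) (hq : 1 < q) (hC : C4 ≤ D ^ (q - 1))
    (hρ : 0 ≤ ρ) (hl : 1 ≤ l) (hrn : rn ≤ C4 * ρ ^ (q ^ l))
    (h : D * ρ ≤ (1 / 2 : ℝ) ^ (q ^ a)) : D * rn ≤ (1 / 2 : ℝ) ^ (q ^ (a + l)) := by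
  have hq0 : 0 < q := by linarith
  have hD0 : 0 < D := by linarith
  have hql : q ≤ q ^ l := by
    conv_lhs => rw [← pow_one q]
    exact pow_le_pow_right₀ hq.le hl
  have h1 : C4 ≤ D ^ (q ^ l - 1) := hC.trans (Real.rpow_le_rpow_of_exponent_le hD (by linarith))
  calc D * rn ≤ D * (D ^ (q ^ l - 1) * ρ ^ (q ^ l)) := by
        gcongr
        exact hrn.trans (by gcongr)
    _ = (D * ρ) ^ (q ^ l) := by
        rw [Real.mul_rpow hD0.le hρ, Real.rpow_sub hD0, Real.rpow_one]; field_simp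
    _ ≤ ((1 / 2 : ℝ) ^ (q ^ a)) ^ (q ^ l) := by gcongr
    _ = _ := by rw [← Real.rpow_mul (by norm_num), ← pow_add]

theorem aux_restart (K T₀ ζ β C3 R rk rn ρ θ : ℝ) (hK : 0 < K) (hK1 : K < 1) (hT : 0 < T₀)
    (hC3 : 0 < C3) (hρ : 0 < ρ) (hρ1 : ρ ≤ 1) (hrk : rk ≤ ρ)
    (hβ : ζ ≤ 1 - β) (hrn : rn ≤ K * R + C3 * rk * ρ ^ (1 - β))
    (hcase : (R ≤ rn + T₀ * ρ ^ ζ * (2 * ρ) ∧ θ ≤ 1 + ζ) ∨ (R = 0 ∧ θ ≤ 2 - β)) :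
    rn ≤ (2 * T₀ + C3) / (1 - K) * ρ ^ θ := by
  have h1K : 0 < 1 - K := by linarith
  have e1 : ρ * ρ ^ (1 - β) = ρ ^ (2 - β) := by
    rw [show 2 - β = 1 + (1 - β) by ring, Real.rpow_add hρ, Real.rpow_one]
  have e2 : ρ ^ ζ * ρ = ρ ^ (1 + ζ) := by
    rw [Real.rpow_add hρ, Real.rpow_one]; ring
  have h1 : C3 * rk * ρ ^ (1 - β) ≤ C3 * ρ ^ (2 - β) := by
    rw [← e1, mul_assoc]; gcongr
  rcases hcase with ⟨h2, h3⟩ | ⟨h2, h3⟩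
  · have h4 : ρ ^ (2 - β) ≤ ρ ^ (1 + ζ) :=
      Real.rpow_le_rpow_of_exponent_ge hρ hρ1 (by linarith)
    have h5 : ρ ^ (1 + ζ) ≤ ρ ^ θ := Real.rpow_le_rpow_of_exponent_ge hρ hρ1 (by linarith)
    have h6 : T₀ * ρ ^ ζ * (2 * ρ) = 2 * T₀ * ρ ^ (1 + ζ) := by rw [← e2]; ring
    rw [h6] at h2
    have h7 : 0 ≤ ρ ^ θ := by positivity
    have h8 : 0 ≤ ρ ^ (1 + ζ) := by positivity
    rw [div_mul_eq_mul_div, le_div_iff₀ h1K]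
    have := mul_le_mul_of_nonneg_left h2 hK.le
    have := mul_le_mul_of_nonneg_left h4 hC3.le
    have := mul_le_mul_of_nonneg_left h5 (by linarith : 0 ≤ 2 * T₀ + C3)
    have : K * (2 * T₀ * ρ ^ (1 + ζ)) ≤ 1 * (2 * T₀ * ρ ^ (1 + ζ)) := by gcongr
    linarith
  · have h5 : ρ ^ (2 - β) ≤ ρ ^ θ := Real.rpow_le_rpow_of_exponent_ge hρ hρ1 (by linarith)
    have h7 : 0 ≤ ρ ^ θ := by positivity
    have h8 : C3 ≤ (2 * T₀ + C3) / (1 - K) := by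
      rw [le_div_iff₀ h1K]; nlinarith
    rw [h2] at hrn
    calc rn ≤ C3 * ρ ^ (2 - β) := by linarith
      _ ≤ C3 * ρ ^ θ := by gcongr
      _ ≤ _ := by gcongr

theorem aux_order (p : ℕ) (hp : 0 < p) (ζ α q : ℝ) (hζ0 : 0 < ζ) (hζ1 : ζ < 1 / (2 * (p : ℝ)))
    (hα : α = min ζ (1 - 2 * (p : ℝ) * ζ)) (hq : q = (1 + α) ^ (1 / (p : ℝ))) :
    1 < q ∧ (∀ l ≤ p, q ^ l ≤ 1 + ζ) ∧ q ^ (p + 1) ≤ 2 - ((p - 1 : ℕ) : ℝ) * ζ ∧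
      ζ ≤ 1 - ((p - 1 : ℕ) : ℝ) * ζ := by
  have hp0 : (0 : ℝ) < p := by exact_mod_cast hp
  have hp1 : (1 : ℝ) ≤ p := by exact_mod_cast hp
  rw [lt_div_iff₀ (by positivity)] at hζ1
  have hα1 : α ≤ ζ := hα ▸ min_le_left _ _
  have hα2 : α ≤ 1 - 2 * p * ζ := hα ▸ min_le_right _ _
  have hα0 : 0 < α := by
    rw [hα]; apply lt_min hζ0; linarith
  have hq1 : 1 < q := by
    rw [hq]; exact Real.one_lt_rpow (by linarith) (by positivity)
  have hqp : q ^ p = 1 + α := by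
    rw [hq, ← Real.rpow_mul_natCast (by linarith), one_div, inv_mul_cancel₀ hp0.ne', Real.rpow_one]
  have hcast : ((p - 1 : ℕ) : ℝ) = p - 1 := by
    rw [Nat.cast_sub hp]; simp
  have hpz : ζ ≤ p * ζ := by nlinarith
  have hqα : q ≤ 1 + α := by
    rw [← hqp]
    conv_lhs => rw [← pow_one q]
    exact pow_le_pow_right₀ hq1.le hp
  refine ⟨hq1, fun l hl => ?_, ?_, ?_⟩
  · have : q ^ l ≤ q ^ p := pow_le_pow_right₀ hq1.le hl
    linarith
  · rw [pow_succ, hqp, hcast]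
    have hα3 : α < 1 := by nlinarith
    have : (1 + α) * q ≤ (1 + α) * (1 + α) := by gcongr
    nlinarith
  · rw [hcast]; nlinarith

set_option maxHeartbeats 1000000 in
theorem aux_run {n p : ℕ} (hp : 0 < p)
    (U : Set (EuclideanSpace ℝ (Fin n)))
    (f : EuclideanSpace ℝ (Fin n) → EuclideanSpace ℝ (Fin p))
    (g : EuclideanSpace ℝ (Fin n) → EuclideanSpace ℝ (Fin n))
    (xs : EuclideanSpace ℝ (Fin n))
    (A : EuclideanSpace ℝ (Fin n) →L[ℝ] EuclideanSpace ℝ (Fin p))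
    (B : EuclideanSpace ℝ (Fin n) →L[ℝ] EuclideanSpace ℝ (Fin n))
    (K L L' σ μ T₀ ζ C1 C2 C3 C4 D q : ℝ)
    (hK : 0 < K) (hL : 0 < L) (hL' : 0 < L') (hσ : 0 < σ) (hKμ : K < μ) (hμ1 : μ < 1)
    (hT₀ : 0 < T₀) (hζ0 : 0 < ζ)
    (hC1 : C1 = K * (L / 2) + ‖A‖ * (L' / 2))
    (hC2 : C2 = (2 * p * (p + 1) / (1 - μ) * (2 / T₀) ^ (p - 1) + 1) / σ ^ 2)
    (hC3 : C3 = C1 * C2 + L / (2 * σ ^ 2)) (hC4 : C4 = (2 * T₀ + C3) / (1 - K))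
    (hD : 1 ≤ D) (hDC : C4 ≤ D ^ (q - 1))
    (hq1 : 1 < q) (hq2 : ∀ l ≤ p, q ^ l ≤ 1 + ζ) (hq3 : q ^ (p + 1) ≤ 2 - ((p - 1 : ℕ) : ℝ) * ζ)
    (hq4 : ζ ≤ 1 - ((p - 1 : ℕ) : ℝ) * ζ)
    (hA : ∀ v, σ * ‖v‖ ≤ ‖A v‖)
    (hAB : ∀ v, ‖A (B v)‖ ≤ K * ‖A v‖)
    (hA2 : ∀ x ∈ U, σ * ‖x - xs‖ ≤ ‖f x‖)
    (htay1 : ∀ x ∈ U, ‖f x - A (x - xs)‖ ≤ L / 2 * ‖x - xs‖ ^ 2)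
    (htay2 : ∀ x ∈ U, ‖g x - xs - B (x - xs)‖ ≤ L' / 2 * ‖x - xs‖ ^ 2)
    (x : ℕ → EuclideanSpace ℝ (Fin n)) (m : ℕ → ℕ) (c : ℕ → ℕ → ℝ)
    (hx0 : x 0 ∈ U)
    (hs1 : ∀ ρ, 0 < ρ → ρ ≤ ‖f (x 0)‖ → ρ ≤ 1)
    (hs2 : ∀ ρ, 0 < ρ → ρ ≤ ‖f (x 0)‖ → T₀ * ρ ^ ζ ≤ 1)
    (hs3 : ∀ ρ, 0 < ρ → ρ ≤ ‖f (x 0)‖ → C3 * ρ ^ (1 - ((p - 1 : ℕ) : ℝ) * ζ) ≤ μ - K)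
    (hs4 : ∀ w, σ * ‖w - xs‖ ≤ ‖f (x 0)‖ → w ∈ U)
    (hs5 : D * ‖f (x 0)‖ ≤ 1 / 2)
    (hrun : RestartRunAdaptive f g T₀ ζ x m c) :
    ∀ k, m k ≤ k ∧ m k ≤ p ∧ (∀ j ≤ k, x j ∈ U) ∧
      (∀ j < k, ‖f (x (j + 1))‖ ≤ μ * ‖f (x j)‖) ∧
      (∀ j < m k, ∀ b : ℕ → ℝ, T₀ * ‖f (x (k - m k))‖ ^ ζ *
        ‖f (x (k - m k + (j + 1))) - f (x (k - m k))‖ ≤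
        ‖f (x (k - m k + (j + 1))) - f (x (k - m k)) - ∑ i ∈ Finset.range j,
          b i • (f (x (k - m k + (i + 1))) - f (x (k - m k)))‖) ∧
      (1 ≤ m k → f (x k) ≠ 0) ∧
      D * ‖f (x (k - m k))‖ ≤ (1 / 2 : ℝ) ^ (q ^ (k - m k)) := by
  obtain ⟨hm0, hrun⟩ := hrun
  have hμ0 : 0 < μ := hK.trans hKμ
  have h1μ : 0 < 1 - μ := by linarith
  have hC10 : 0 < C1 := by rw [hC1]; positivity
  have hC20 : 0 < C2 := by rw [hC2]; positivity
  have hC30 : 0 < C3 := by rw [hC3]; positivity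
  intro k
  induction k with
  | zero =>
    refine ⟨hm0.le, by omega, fun j hj => ?_, fun j hj => by omega, fun j hj => by omega,
      fun h => by omega, ?_⟩
    · have : j = 0 := by omega
      rw [this]; exact hx0
    · simpa using hs5
  | succ k ih =>
    obtain ⟨hmk, hmp, hxU, hdec, hsep, hnz, hDk⟩ := ih
    obtain ⟨R1, R2, R3, R4, R5⟩ := hrun k
    by_cases hfk : f (x k) = 0
    · have hxk := R1 hfk
      have hf1 : f (x (k + 1)) = 0 := by rw [hxk, hfk]
      have hm1 := R2 hf1
      refine ⟨by omega, by omega, fun j hj => ?_, fun j hj => ?_, fun j hj => by omega,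
        fun h => by omega, ?_⟩
      · rcases Nat.lt_succ_iff_lt_or_eq.mp (Nat.lt_succ_of_le hj) with h | rfl
        · exact hxU j (by omega)
        · rw [hxk]; exact hxU k le_rfl
      · rcases Nat.lt_succ_iff_lt_or_eq.mp hj with h | rfl
        · exact hdec j h
        · rw [hf1, hfk]; simp
      · rw [hm1]
        simp only [Nat.sub_zero, hf1, norm_zero, mul_zero]
        positivity
    · -- uniform description of the step
      obtain ⟨hc, hmin, hxk⟩ : (∑ i ∈ Finset.range (m k + 1), c k i) = 1 ∧
          (∀ d : ℕ → ℝ, (∑ i ∈ Finset.range (m k + 1), d i) = 1 →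
          ‖∑ i ∈ Finset.range (m k + 1), c k i • f (x (k - m k + i))‖ ≤
            ‖∑ i ∈ Finset.range (m k + 1), d i • f (x (k - m k + i))‖) ∧
          x (k + 1) = ∑ i ∈ Finset.range (m k + 1), c k i • g (x (k - m k + i)) := by
        rcases Nat.eq_zero_or_pos (m k) with h0 | h0
        · obtain ⟨h1, h2⟩ := R3 hfk h0
          rw [h0]
          simp only [zero_add, Finset.range_one, Finset.sum_singleton]
          refine ⟨h2, fun d hd => ?_, ?_⟩
          · rw [hd, h2]
          · rw [h2, h1]; simp
        · exact R4 hfk h0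
      have hpow : ∀ a i, a + i ≤ k → ‖f (x (a + i))‖ ≤ μ ^ i * ‖f (x a)‖ := by
        intro a i
        induction i with
        | zero => intro _; simp
        | succ i ih =>
          intro hi
          have h1 := ih (by omega)
          have h2 := hdec (a + i) (by omega)
          rw [pow_succ]
          calc _ ≤ _ := h2
            _ ≤ μ * (μ ^ i * ‖f (x a)‖) := by gcongr
            _ = _ := by ring
      obtain ⟨a, ha⟩ : ∃ a, a = k - m k := ⟨_, rfl⟩
      have hak : a + m k = k := by omega
      have hfkpos : 0 < ‖f (x k)‖ := norm_pos_iff.mpr hfk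
      rw [← ha] at hmin hxk hsep hDk R5
      have hrkρ : ‖f (x k)‖ ≤ ‖f (x a)‖ := by
        have := hpow a (m k) (by omega)
        rw [hak] at this
        have h1 : μ ^ m k ≤ 1 := pow_le_one₀ hμ0.le hμ1.le
        have := norm_nonneg (f (x a))
        nlinarith
      have hρ0 : 0 < ‖f (x a)‖ := by linarith
      have hρx : ‖f (x a)‖ ≤ ‖f (x 0)‖ := by
        have := hpow 0 a (by omega)
        rw [zero_add] at this
        have h1 : μ ^ a ≤ 1 := pow_le_one₀ hμ0.le hμ1.le
        have := norm_nonneg (f (x 0))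
        nlinarith
      have hdecy : ∀ i, 1 ≤ i → i ≤ m k → ‖f (x (a + i))‖ ≤ μ * ‖f (x a)‖ := by
        intro i h1 h2
        refine (hpow a i (by omega)).trans ?_
        gcongr
        calc μ ^ i ≤ μ ^ 1 := pow_le_pow_of_le_one hμ0.le hμ1.le h1
          _ = μ := pow_one μ
      have hRle : ‖∑ i ∈ Finset.range (m k + 1), c k i • f (x (a + i))‖ ≤ ‖f (x k)‖ := by
        have := hmin (fun i => if i = m k then 1 else 0) (by simp)
        simpa [hak] using this
      obtain ⟨S1, S2, S3⟩ := aux_step f g xs A B K L L' σ μ T₀ ζ C1 C2 C3 p hp hK hL hL' hσ hKμ hμ1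
        hT₀ hζ0 hC1 hC2 hC3 U hA hAB hA2 htay1 htay2 (m k) hmp (fun i => x (a + i)) (c k) hc
        (fun i hi => hxU _ (by omega)) (by simpa only [hak] using hRle) hdecy hρ0 hsep
        (hs1 _ hρ0 hρx) (hs2 _ hρ0 hρx) (hs3 _ hρ0 hρx) (fun w hw => hs4 w (hw.trans hρx))
      simp only [← hxk, hak, add_zero] at S1 S2 S3
      set ρ := ‖f (x a)‖ with hρ
      have hτ0 : 0 < T₀ * ρ ^ ζ := by positivity
      have hU' : ∀ j ≤ k + 1, x j ∈ U := by
        intro j hj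
        rcases Nat.lt_succ_iff_lt_or_eq.mp (Nat.lt_succ_of_le hj) with h | rfl
        · exact hxU j (by omega)
        · exact S1
      have hdec' : ∀ j < k + 1, ‖f (x (j + 1))‖ ≤ μ * ‖f (x j)‖ := by
        intro j hj
        rcases Nat.lt_succ_iff_lt_or_eq.mp hj with h | rfl
        · exact hdec j h
        · exact S3
      have hrn : ‖f (x (k + 1))‖ ≤ μ * ρ := S3.trans (by gcongr)
      have hsnorm : ‖f (x (k + 1)) - f (x a)‖ ≤ 2 * ρ := by
        refine (norm_sub_le _ _).trans ?_
        have : μ * ρ ≤ 1 * ρ := by gcongr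
        linarith
      have hμρ : μ * ρ < ρ := mul_lt_of_lt_one_left hρ0 hμ1
      have hsurj : m k = p → ∀ w, ∃ d : ℕ → ℝ,
          w = ∑ i ∈ Finset.range (m k), d i • (f (x (a + (i + 1))) - f (x a)) := by
        intro hmkp
        refine aux_surj (fun i => f (x (a + (i + 1))) - f (x a)) _ hτ0 (hs2 _ hρ0 hρx) (m k)
          (by simpa using hmkp) hsep ?_
        intro j hj h0
        have h1 := hdecy (j + 1) (by omega) (by omega)
        rw [sub_eq_zero.mp h0] at h1
        exact absurd h1 (not_le.mpr hμρ)
      have hspan := aux_span (fun i => f (x (a + i)) - f (x a)) (m k)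
      set W := Submodule.span ℝ ((fun i => f (x (a + i)) - f (x a)) '' Set.Icc 1 (m k)) with hW
      have hrestart : m (k + 1) = 0 → D * ‖f (x (k + 1))‖ ≤ (1 / 2 : ℝ) ^ (q ^ (k + 1)) := by
        intro hm1
        by_cases hf1 : f (x (k + 1)) = 0
        · rw [hf1]; simp; positivity
        obtain ⟨T1, T2⟩ := R5 hf1
        have hgt : T₀ * ρ ^ ζ * ‖f (x (k + 1)) - f (x a)‖ >
            Metric.infDist (f (x (k + 1)) - f (x a)) (W : Set (EuclideanSpace ℝ (Fin p))) := by
          by_contra hcon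
          have := T2 (not_lt.mp hcon)
          omega
        have hb : ‖f (x (k + 1))‖ ≤ C4 * ρ ^ (q ^ (m k + 1)) := by
          rw [hC4]
          refine aux_restart K T₀ ζ (((p - 1 : ℕ) : ℝ) * ζ) C3 _ (‖f (x k)‖) _ ρ _ hK
            (hKμ.trans hμ1) hT₀ hC30 hρ0 (hs1 _ hρ0 hρx) hrkρ hq4 S2 ?_
          rcases Nat.lt_or_ge (m k) p with hlt | hge
          · left
            refine ⟨?_, hq2 _ hlt⟩
            obtain ⟨w, hw, hwd⟩ := (Metric.infDist_lt_iff ⟨0, W.zero_mem⟩).mp hgt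
            obtain ⟨d, hd⟩ := (hspan w).mp hw
            obtain ⟨e, he, he2⟩ := aux_affine' (F := EuclideanSpace ℝ (Fin p)) (m k) d
            have h1 := hmin e he
            have h2 := he2 (fun i => f (x (a + i)))
            simp only [add_zero] at h2
            rw [h2, ← hd] at h1
            refine h1.trans ?_
            rw [dist_eq_norm] at hwd
            have h3 : f (x a) + w = f (x (k + 1)) - (f (x (k + 1)) - f (x a) - w) := by abel
            rw [h3]
            refine (norm_sub_le _ _).trans ?_
            gcongr
            exact hwd.le.trans (by gcongr)
          · right
            have hmkp : m k = p := le_antisymm hmp hge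
            refine ⟨?_, by rw [hmkp]; exact hq3⟩
            obtain ⟨d, hd⟩ := hsurj hmkp (-f (x a))
            obtain ⟨e, he, he2⟩ := aux_affine' (F := EuclideanSpace ℝ (Fin p)) (m k) d
            have h1 := hmin e he
            have h2 := he2 (fun i => f (x (a + i)))
            simp only [add_zero] at h2
            rw [h2, ← hd] at h1
            simpa using h1
        have := aux_final D q C4 _ ρ a (m k + 1) hD hq1 hDC hρ0.le (by omega) hb hDk
        rwa [show a + (m k + 1) = k + 1 by omega] at this
      have hcase : m (k + 1) = 0 ∨ (f (x (k + 1)) ≠ 0 ∧ m (k + 1) = m k + 1 ∧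
          T₀ * ρ ^ ζ * ‖f (x (k + 1)) - f (x a)‖ ≤
            Metric.infDist (f (x (k + 1)) - f (x a)) (W : Set (EuclideanSpace ℝ (Fin p)))) := by
        by_cases hf1 : f (x (k + 1)) = 0
        · exact Or.inl (R2 hf1)
        · obtain ⟨T1, T2⟩ := R5 hf1
          rcases lt_or_ge (Metric.infDist (f (x (k + 1)) - f (x a))
            (W : Set (EuclideanSpace ℝ (Fin p)))) (T₀ * ρ ^ ζ * ‖f (x (k + 1)) - f (x a)‖)
            with h | h
          · exact Or.inl (T1 h)
          · exact Or.inr ⟨hf1, T2 h, h⟩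
      rcases hcase with hm1 | ⟨hf1, hm1, hle⟩
      · refine ⟨by omega, by omega, hU', hdec', fun j hj => by omega, fun h => by omega, ?_⟩
        rw [hm1]
        exact hrestart hm1
      · have hbase : k + 1 - m (k + 1) = a := by omega
        have hle2 : ∀ w ∈ W, T₀ * ρ ^ ζ * ‖f (x (k + 1)) - f (x a)‖ ≤
            ‖f (x (k + 1)) - f (x a) - w‖ := by
          intro w hw
          rw [← dist_eq_norm]
          exact hle.trans (Metric.infDist_le_dist_of_mem hw)
        have hnp : m k ≠ p := by
          intro hmkp
          have h1 := hle2 _ ((hspan _).mpr (hsurj hmkp (f (x (k + 1)) - f (x a))))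
          rw [sub_self, norm_zero] at h1
          have h2 : 0 < ‖f (x (k + 1)) - f (x a)‖ := by
            rw [norm_pos_iff]
            intro h0
            have h3 : ρ ≤ μ * ρ := by
              have h4 := hrn
              rw [sub_eq_zero.mp h0] at h4
              exact h4
            exact absurd h3 (not_le.mpr hμρ)
          have := mul_pos hτ0 h2
          linarith
        refine ⟨by omega, by omega, hU', hdec', fun j hj b => ?_, fun _ => hf1, ?_⟩
        · rw [hbase]
          rw [hm1] at hj
          rcases Nat.lt_succ_iff_lt_or_eq.mp hj with h | rfl
          · exact hsep j h b
          · rw [show a + (m k + 1) = k + 1 by omega]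
            exact hle2 _ ((hspan _).mpr ⟨b, rfl⟩)
        · rw [hbase]; exact hDk

/-- Superlinear convergence of the restarted Anderson–Pulay acceleration
with adaptive restart parameter `τ⁽ᵏ⁻ᵐ_k⁾ = T₀‖r⁽ᵏ⁻ᵐ_k⁾‖₂^ζ`, `ζ ∈ (0, 1/(2p))`
(version A, `Σ = ℝⁿ`): for `‖r⁽⁰⁾‖₂` small enough the sequence is well defined, satisfies
`m_k ≤ min(k,p)` and `‖r⁽ᵏ⁾‖ ≤ μᵏ‖r⁽⁰⁾‖`, and converges superlinearly to `x*` with r-order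
at least `(1 + min{ζ, 1 − 2pζ})^{1/p}`. -/
theorem stmt12
    (n p : ℕ) (hn : 0 < n) (hp : 0 < p)
    (V U : Set (EuclideanSpace ℝ (Fin n)))
    (f : EuclideanSpace ℝ (Fin n) → EuclideanSpace ℝ (Fin p))
    (g : EuclideanSpace ℝ (Fin n) → EuclideanSpace ℝ (Fin n))
    (xs : EuclideanSpace ℝ (Fin n)) (K σ L L' : ℝ)
    (hV : IsOpen V) (hxsV : xs ∈ V)
    (hf : ContDiffOn ℝ 2 f V) (hg : ContDiffOn ℝ 2 g V)
    (hfix : g xs = xs) (hroot : f xs = 0)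
    (hK0 : 0 < K) (hK1 : K < 1)
    (hA1 : ∀ x ∈ V, g x ∈ V → ‖f (g x)‖ ≤ K * ‖f x‖)
    (hσ : 0 < σ) (hA2 : ∀ x ∈ V, σ * ‖x - xs‖ ≤ ‖f x‖)
    (hU : U ∈ nhds xs) (hUV : U ⊆ V) (hUg : ∀ x ∈ U, g x ∈ V)
    (hL : 0 < L) (hL' : 0 < L')
    (hlip1 : ∀ x ∈ U, ∀ y ∈ U, ‖f x - f y‖ ≤ 2 * ‖fderiv ℝ f xs‖ * ‖x - y‖)
    (hlip2 : ∀ x ∈ U, ∀ y ∈ U,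
      ‖f (g x) - f (g y)‖ ≤ 2 * ‖(fderiv ℝ f xs).comp (fderiv ℝ g xs)‖ * ‖x - y‖)
    (htay1 : ∀ x ∈ U, ‖f x - fderiv ℝ f xs (x - xs)‖ ≤ L / 2 * ‖x - xs‖ ^ 2)
    (htay2 : ∀ x ∈ U, ‖g x - xs - fderiv ℝ g xs (x - xs)‖ ≤ L' / 2 * ‖x - xs‖ ^ 2)
    (μ : ℝ) (hKμ : K < μ) (hμ1 : μ < 1)
    (T₀ : ℝ) (hT₀ : 0 < T₀) (ζ : ℝ) (hζ0 : 0 < ζ) (hζ1 : ζ < 1 / (2 * (p : ℝ))) :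
    ∃ ε : ℝ, 0 < ε ∧
    ∀ x0 ∈ U, 0 < ‖f x0‖ → ‖f x0‖ < ε →
    (∃ x m c, x 0 = x0 ∧ RestartRunAdaptive f g T₀ ζ x m c) ∧
    ∀ (x : ℕ → EuclideanSpace ℝ (Fin n)) (m : ℕ → ℕ) (c : ℕ → ℕ → ℝ),
      x 0 = x0 → RestartRunAdaptive f g T₀ ζ x m c →
      (∀ k, m k ≤ min k p) ∧
      (∀ k, ‖f (x k)‖ ≤ μ ^ k * ‖f x0‖) ∧
      ∃ b : ℝ, 0 < b ∧ ∃ η : ℝ, 0 < η ∧ η < 1 ∧ ∃ N : ℕ, ∀ k, N ≤ k →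
        ‖x k - xs‖ ≤
          b * η ^ (((1 + min ζ (1 - 2 * (p : ℝ) * ζ)) ^ (1 / (p : ℝ))) ^ k) := by
  set A := fderiv ℝ f xs with hAdef
  set B := fderiv ℝ g xs with hBdef
  have hVn : V ∈ 𝓝 xs := hV.mem_nhds hxsV
  have hfd : HasFDerivAt f A xs :=
    ((hf.contDiffAt hVn).differentiableAt (by norm_num)).hasFDerivAt
  have hgd : HasFDerivAt g B xs :=
    ((hg.contDiffAt hVn).differentiableAt (by norm_num)).hasFDerivAt
  have hA : ∀ v, σ * ‖v‖ ≤ ‖A v‖ := by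
    intro v
    have h1 := aux_fderiv_le (fun x => x - xs) f (ContinuousLinearMap.id ℝ _) A xs
      ((hasFDerivAt_id xs).sub_const xs) hfd (by simp) hroot (1 / σ) (by
        filter_upwards [hVn] with x hx
        have := hA2 x hx
        rw [div_mul_eq_mul_div, le_div_iff₀ hσ]; linarith) v
    rw [div_mul_eq_mul_div, le_div_iff₀ hσ] at h1
    simp at h1
    linarith
  have hAB : ∀ v, ‖A (B v)‖ ≤ K * ‖A v‖ := by
    intro v
    have hfd' : HasFDerivAt f A (g xs) := by rw [hfix]; exact hfd
    have h1 := aux_fderiv_le (f ∘ g) f (A.comp B) A xs (hfd'.comp xs hgd) hfd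
      (by simp [hfix, hroot]) hroot K (by
        filter_upwards [hU] with x hx
        exact hA1 x (hUV hx) (hUg x hx)) v
    simpa using h1
  have hμ0 : 0 < μ := hK0.trans hKμ
  have h1μ : 0 < 1 - μ := by linarith
  obtain ⟨q, hq⟩ : ∃ q, q = (1 + min ζ (1 - 2 * (p : ℝ) * ζ)) ^ (1 / (p : ℝ)) := ⟨_, rfl⟩
  obtain ⟨hq1, hq2, hq3, hq4⟩ := aux_order p hp ζ _ q hζ0 hζ1 rfl hq
  rw [← hq]
  obtain ⟨C1, hC1⟩ : ∃ C1, C1 = K * (L / 2) + ‖A‖ * (L' / 2) := ⟨_, rfl⟩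
  obtain ⟨C2, hC2⟩ : ∃ C2, C2 = (2 * p * (p + 1) / (1 - μ) * (2 / T₀) ^ (p - 1) + 1) / σ ^ 2 :=
    ⟨_, rfl⟩
  obtain ⟨C3, hC3⟩ : ∃ C3, C3 = C1 * C2 + L / (2 * σ ^ 2) := ⟨_, rfl⟩
  obtain ⟨C4, hC4⟩ : ∃ C4, C4 = (2 * T₀ + C3) / (1 - K) := ⟨_, rfl⟩
  obtain ⟨D, hD, hDC⟩ : ∃ D : ℝ, 1 ≤ D ∧ C4 ≤ D ^ (q - 1) := by
    have h1 := (tendsto_rpow_atTop (by linarith : 0 < q - 1)).eventually_ge_atTop C4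
    obtain ⟨D, h2, h3⟩ := ((eventually_ge_atTop (1 : ℝ)).and h1).exists
    exact ⟨D, h2, h3⟩
  have hD0 : 0 < D := by linarith
  obtain ⟨δ, hδ, hδU⟩ := Metric.mem_nhds_iff.mp hU
  have hpw : ∀ e : ℝ, 0 < e → ∀ C : ℝ, Tendsto (fun ρ : ℝ => C * ρ ^ e) (𝓝[>] 0) (𝓝 0) := by
    intro e he C
    have h1 : Tendsto (fun ρ : ℝ => ρ ^ e) (𝓝 0) (𝓝 ((0 : ℝ) ^ e)) :=
      (Real.continuousAt_rpow_const 0 e (Or.inr he.le)).tendsto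
    rw [Real.zero_rpow he.ne'] at h1
    have := (h1.const_mul C).mono_left (nhdsWithin_le_nhds (s := Set.Ioi 0))
    simpa using this
  have hev : ∀ᶠ ρ in 𝓝[>] (0 : ℝ), T₀ * ρ ^ ζ ≤ 1 ∧
      C3 * ρ ^ (1 - ((p - 1 : ℕ) : ℝ) * ζ) ≤ μ - K :=
    ((hpw ζ hζ0 T₀).eventually_le_const one_pos).and
      ((hpw _ (by linarith) C3).eventually_le_const (by linarith))
  obtain ⟨ε₁, hε₁, hsub⟩ := mem_nhdsGT_iff_exists_Ioo_subset.mp hev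
  have hε₁ : 0 < ε₁ := hε₁
  refine ⟨min (min ε₁ 1) (min (1 / (2 * D)) (δ * σ)), by positivity, ?_⟩
  intro x0 hx0 hx0pos hx0lt
  have l1 : ‖f x0‖ < ε₁ := lt_of_lt_of_le hx0lt ((min_le_left _ _).trans (min_le_left _ _))
  have l2 : ‖f x0‖ < 1 := lt_of_lt_of_le hx0lt ((min_le_left _ _).trans (min_le_right _ _))
  have l3 : ‖f x0‖ < 1 / (2 * D) := lt_of_lt_of_le hx0lt ((min_le_right _ _).trans (min_le_left _ _))
  have l4 : ‖f x0‖ < δ * σ := lt_of_lt_of_le hx0lt ((min_le_right _ _).trans (min_le_right _ _))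
  refine ⟨aux_exist f g T₀ ζ x0, ?_⟩
  intro x m c hx hrun
  have inv := aux_run hp U f g xs A B K L L' σ μ T₀ ζ C1 C2 C3 C4 D q hK0 hL hL' hσ hKμ hμ1 hT₀ hζ0
    hC1 hC2 hC3 hC4 hD hDC hq1 hq2 hq3 hq4 hA hAB (fun y hy => hA2 y (hUV hy)) htay1 htay2 x m c
    (by rw [hx]; exact hx0)
    (fun ρ _ h2 => by rw [hx] at h2; linarith)
    (fun ρ h1 h2 => by rw [hx] at h2; exact (hsub ⟨h1, by linarith⟩).1)
    (fun ρ h1 h2 => by rw [hx] at h2; exact (hsub ⟨h1, by linarith⟩).2)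
    (fun w hw => by
      rw [hx] at hw
      apply hδU
      rw [Metric.mem_ball, dist_eq_norm]
      have : σ * ‖w - xs‖ < σ * δ := by linarith
      exact lt_of_mul_lt_mul_left this hσ.le)
    (by
      rw [hx]
      rw [lt_div_iff₀ (by positivity)] at l3
      linarith)
    hrun
  have hdec : ∀ j, ‖f (x (j + 1))‖ ≤ μ * ‖f (x j)‖ := fun j => (inv (j + 1)).2.2.2.1 j (by omega)
  have hpow : ∀ a i, ‖f (x (a + i))‖ ≤ μ ^ i * ‖f (x a)‖ := by
    intro a i
    induction i with
    | zero => simp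
    | succ i ih =>
      rw [pow_succ]
      calc _ ≤ _ := hdec (a + i)
        _ ≤ μ * (μ ^ i * ‖f (x a)‖) := by gcongr
        _ = _ := by ring
  refine ⟨fun k => le_min (inv k).1 (inv k).2.1, fun k => ?_, ?_⟩
  · have := hpow 0 k
    rwa [zero_add, hx] at this
  have hq0 : 0 < q := by linarith
  refine ⟨1 / (D * σ), by positivity, (1 / 2 : ℝ) ^ ((q ^ p)⁻¹), by positivity,
    Real.rpow_lt_one (by norm_num) (by norm_num) (by positivity), p, fun k hk => ?_⟩
  obtain ⟨i1, i2, i3, -, -, -, i7⟩ := inv k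
  have h1 := hA2 (x k) (hUV (i3 k le_rfl))
  have h2 := hpow (k - m k) (m k)
  rw [show k - m k + m k = k by omega] at h2
  have h3 : ‖f (x k)‖ ≤ ‖f (x (k - m k))‖ := by
    have : μ ^ m k ≤ 1 := pow_le_one₀ hμ0.le hμ1.le
    have := norm_nonneg (f (x (k - m k)))
    nlinarith
  have h4 : (1 / 2 : ℝ) ^ (q ^ (k - m k)) ≤ (1 / 2 : ℝ) ^ (q ^ (k - p)) := by
    apply Real.rpow_le_rpow_of_exponent_ge (by norm_num) (by norm_num)
    exact pow_le_pow_right₀ hq1.le (by omega)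
  have h5 : ((1 / 2 : ℝ) ^ ((q ^ p)⁻¹)) ^ (q ^ k) = (1 / 2 : ℝ) ^ (q ^ (k - p)) := by
    rw [← Real.rpow_mul (by norm_num)]
    congr 1
    rw [pow_sub₀ q hq0.ne' hk]; ring
  rw [h5, div_mul_eq_mul_div, le_div_iff₀ (by positivity)]
  have h6 : D * (σ * ‖x k - xs‖) ≤ D * ‖f (x (k - m k))‖ := by
    gcongr
    linarith
  linarith
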